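/- Let R be a ring and M a left R-module. Then the character module M^+ = Hom_ℤ(M, ℚ/ℤ) is a pure injective right R-module. -/

import Mathlib

universe u

/-! Common definitions: character modules, purity, pure injectivity. -/

open MulOpposite


/-- The character group `M⁺ = Hom_ℤ(M, ℚ/ℤ)`. -/
def CharMod (M : Type u) [AddCommGroup M] : Type u := M →+ AddCircle (1 : ℚ)

instance (M : Type u) [AddCommGroup M] : AddCommGroup (CharMod M) :=
  inferInstanceAs (AddCommGroup (M →+ AddCircle (1 : ℚ)))

instance (M : Type u) [AddCommGroup M] : FunLike (CharMod M) M (AddCircle (1 : ℚ)) :=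
  inferInstanceAs (FunLike (M →+ AddCircle (1 : ℚ)) M (AddCircle (1 : ℚ)))

instance (M : Type u) [AddCommGroup M] :
    AddMonoidHomClass (CharMod M) M (AddCircle (1 : ℚ)) :=
  inferInstanceAs (AddMonoidHomClass (M →+ AddCircle (1 : ℚ)) M (AddCircle (1 : ℚ)))

/-- If `M` is a left `R`-module, `M⁺` is a right `R`-module via `(c • r) m = c (r • m)`. -/
instance CharMod.moduleOp (R : Type v) [Ring R] (M : Type u) [AddCommGroup M] [Module R M] :
    Module Rᵐᵒᵖ (CharMod M) where
  smul r c := (c : M →+ AddCircle (1 : ℚ)).comp (DistribMulAction.toAddMonoidHom M r.unop)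
  one_smul c := AddMonoidHom.ext fun m => congrArg c (one_smul R m)
  mul_smul r s c := AddMonoidHom.ext fun m => congrArg c (mul_smul s.unop r.unop m)
  smul_zero r := rfl
  smul_add r c d := rfl
  add_smul r s c := AddMonoidHom.ext fun m => by
    show c ((r.unop + s.unop) • m) = c (r.unop • m) + c (s.unop • m)
    rw [add_smul, map_add]
  zero_smul c := AddMonoidHom.ext fun m => by
    show c ((0 : R) • m) = 0
    rw [zero_smul, map_zero]

@[simp] lemma CharMod.op_smul_apply {R : Type v} [Ring R] {M : Type u} [AddCommGroup M]
    [Module R M] (r : Rᵐᵒᵖ) (c : CharMod M) (m : M) : (r • c) m = c (r.unop • m) := rfl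

/-- If `N` is a right `R`-module, `N⁺` is a left `R`-module via `(r • c) n = c (n • r)`. -/
instance CharMod.moduleUnop (R : Type v) [Ring R] (N : Type u) [AddCommGroup N] [Module Rᵐᵒᵖ N] :
    Module R (CharMod N) where
  smul r c := (c : N →+ AddCircle (1 : ℚ)).comp (DistribMulAction.toAddMonoidHom N (op r))
  one_smul c := AddMonoidHom.ext fun n => congrArg c (one_smul Rᵐᵒᵖ n)
  mul_smul r s c := AddMonoidHom.ext fun n => by
    show c ((op (r * s)) • n) = c (op s • op r • n)
    rw [← mul_smul]; rfl
  smul_zero r := rfl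
  smul_add r c d := rfl
  add_smul r s c := AddMonoidHom.ext fun n => by
    show c ((op (r + s)) • n) = c (op r • n) + c (op s • n)
    rw [show op (r + s) = op r + op s from rfl, add_smul, map_add]
  zero_smul c := AddMonoidHom.ext fun n => by
    show c ((op (0 : R)) • n) = 0
    rw [show op (0 : R) = (0 : Rᵐᵒᵖ) from rfl, zero_smul, map_zero]

@[simp] lemma CharMod.unop_smul_apply {R : Type v} [Ring R] {N : Type u} [AddCommGroup N]
    [Module Rᵐᵒᵖ N] (r : R) (c : CharMod N) (n : N) : (r • c) n = c (op r • n) := rfl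

/-- The dual `f⁺ : C⁺ → A⁺` of a map `f : A → C` of left `R`-modules. -/
def charDual {R : Type v} [Ring R] {A C : Type u} [AddCommGroup A] [Module R A]
    [AddCommGroup C] [Module R C] (f : A →ₗ[R] C) : CharMod C →ₗ[Rᵐᵒᵖ] CharMod A where
  toFun c := (c : C →+ AddCircle (1 : ℚ)).comp f.toAddMonoidHom
  map_add' _ _ := rfl
  map_smul' r c := AddMonoidHom.ext fun a => (congrArg c (f.map_smul r.unop a)).symm

/-- The canonical evaluation map `σ_M : M → M⁺⁺`. -/
def charEval (R : Type v) [Ring R] (M : Type u) [AddCommGroup M] [Module R M] :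
    M →ₗ[R] CharMod (CharMod M) where
  toFun m :=
    { toFun := fun c => c m
      map_zero' := rfl
      map_add' := fun _ _ => rfl }
  map_add' m m' := AddMonoidHom.ext fun c => c.map_add m m'
  map_smul' r m := AddMonoidHom.ext fun c => rfl

/-- A linear map `i : M → N` is a pure monomorphism if it is injective and every
map from a finitely presented module to `N ⧸ im i` lifts to `N`, i.e. the short exact
sequence `0 → M → N → N ⧸ im i → 0` remains exact after applying `Hom(F, -)` for all
finitely presented `F`. -/
def IsPureMono {R : Type v} [Ring R] {M N : Type u} [AddCommGroup M] [Module R M]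
    [AddCommGroup N] [Module R N] (i : M →ₗ[R] N) : Prop :=
  Function.Injective i ∧
    ∀ (F : Type u) [AddCommGroup F] [Module R F], Module.FinitePresentation R F →
      ∀ g : F →ₗ[R] (N ⧸ LinearMap.range i),
        ∃ h : F →ₗ[R] N, (LinearMap.range i).mkQ.comp h = g

/-- A module `E` is pure injective if every map to `E` extends along pure monomorphisms. -/
def IsPureInjective (R : Type v) [Ring R] (E : Type u) [AddCommGroup E] [Module R E] : Prop :=
  ∀ (M N : Type u) [AddCommGroup M] [Module R M] [AddCommGroup N] [Module R N]
    (i : M →ₗ[R] N), IsPureMono i →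
      ∀ f : M →ₗ[R] E, ∃ g : N →ₗ[R] E, g.comp i = f

/-- Finite systems of equations over `A` solvable in `B` are solvable in `A`. -/
lemma pure_solve {S : Type u} [Ring S] {A B : Type u} [AddCommGroup A] [Module S A]
    [AddCommGroup B] [Module S B] (i : A →ₗ[S] B) (hi : IsPureMono i)
    {ι : Type u} [Fintype ι] {M : Type u} (k : ι → M →₀ S) (b : ι → B) (x : M → A)
    (h : ∀ m, i (x m) = ∑ l, k l m • b l) :
    ∃ a : ι → A, ∀ m, x m = ∑ l, k l m • a l := by
  classical
  let s : Finset M := Finset.univ.biUnion fun l => (k l).support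
  let v : M → (ι → S) := fun m l => k l m
  let N : Submodule S (ι → S) := Submodule.span S (s.image v : Set (ι → S))
  have hfp : Module.FinitePresentation S ((ι → S) ⧸ N) := by
    refine Module.finitePresentation_of_surjective N.mkQ N.mkQ_surjective ?_
    rw [Submodule.ker_mkQ]
    exact ⟨_, rfl⟩
  let q := (LinearMap.range i).mkQ
  let g0 : (ι → S) →ₗ[S] (B ⧸ LinearMap.range i) :=
    q.comp (Fintype.linearCombination S b)
  have hN : N ≤ LinearMap.ker g0 := by
    refine Submodule.span_le.2 ?_
    intro w hw
    simp only [Finset.coe_image, Set.mem_image] at hw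
    obtain ⟨m, -, rfl⟩ := hw
    simp only [SetLike.mem_coe, LinearMap.mem_ker, g0, LinearMap.comp_apply, q,
      Fintype.linearCombination_apply, v, ← h m]
    exact (Submodule.Quotient.mk_eq_zero _).2 ⟨_, rfl⟩
  obtain ⟨hl, hhl⟩ := hi.2 _ hfp (N.liftQ g0 hN)
  let c : ι → B := fun l => hl (N.mkQ (Pi.single l 1))
  have hc : ∀ l, ∃ a, i a = b l - c l := by
    intro l
    have h1 := LinearMap.congr_fun hhl (N.mkQ (Pi.single l 1))
    have h2 : q (c l) = q (b l) := by
      refine h1.trans ?_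
      rw [Submodule.mkQ_apply, Submodule.liftQ_apply]
      simp [g0, Fintype.linearCombination_apply_single]
    have h3 : b l - c l ∈ LinearMap.range i := by
      rw [← Submodule.ker_mkQ (LinearMap.range i), LinearMap.mem_ker, map_sub]
      exact sub_eq_zero.2 h2.symm
    exact h3
  choose a ha using hc
  refine ⟨a, fun m => hi.1 ?_⟩
  rw [h m, map_sum]
  simp only [map_smul, ha, smul_sub, Finset.sum_sub_distrib]
  have hz : ∑ l, k l m • c l = 0 := by
    by_cases hm : m ∈ s
    · have hv : N.mkQ (v m) = 0 := by
        rw [Submodule.mkQ_apply, Submodule.Quotient.mk_eq_zero]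
        exact Submodule.subset_span (by simpa using ⟨m, hm, rfl⟩)
      have hv2 : v m = ∑ l, k l m • (Pi.single l 1 : ι → S) := by
        ext l
        simp [v, Finset.sum_apply, Pi.single_apply]
      have := congrArg hl hv
      rw [hv2] at this
      simpa only [map_sum, map_smul, map_zero] using this
    · refine Finset.sum_eq_zero fun l _ => ?_
      have : k l m = 0 := by
        by_contra hne
        exact hm (Finset.mem_biUnion.2 ⟨l, Finset.mem_univ _, Finsupp.mem_support_iff.2 hne⟩)
      rw [this, zero_smul]
  rw [hz, sub_zero]

lemma char_extend {X Y : Type u} [AddCommGroup X] [AddCommGroup Y] (p : X →+ Y)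
    (χ : X →+ AddCircle (1 : ℚ)) (h : ∀ x, p x = 0 → χ x = 0) :
    ∃ χ' : Y →+ AddCircle (1 : ℚ), ∀ x, χ' (p x) = χ x := by
  let p' : X →ₗ[ℤ] Y := p.toIntLinearMap
  let P := (LinearMap.ker p').liftQ p' le_rfl
  have hP : Function.Injective P := LinearMap.ker_eq_bot.1 (Submodule.ker_liftQ_eq_bot _ _ _ le_rfl)
  let c : X ⧸ LinearMap.ker p' →ₗ[ℤ] AddCircle (1 : ℚ) :=
    (LinearMap.ker p').liftQ χ.toIntLinearMap (fun x hx => h x hx)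
  obtain ⟨d, hd⟩ := CharacterModule.dual_surjective_of_injective P hP c.toAddMonoidHom
  refine ⟨d, fun x => ?_⟩
  exact DFunLike.congr_fun hd ((LinearMap.ker p').mkQ x)

/-- Relations among the elements of `M`. -/
abbrev RelM (R : Type u) [Ring R] (M : Type u) [AddCommGroup M] [Module R M] : Type u :=
  {k : M →₀ Rᵐᵒᵖ // (k.sum fun m r => r.unop • m) = 0}

/-- The map whose cokernel is the tensor product of `B` and `M`. -/
noncomputable def relMap (R : Type u) [Ring R] (M : Type u) [AddCommGroup M] [Module R M]
    (B : Type u) [AddCommGroup B] [Module Rᵐᵒᵖ B] : (RelM R M →₀ B) →+ (M →₀ B) :=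
  Finsupp.liftAddHom fun k =>
    { toFun := fun b => k.1.mapRange (fun r => r • b) (zero_smul _ b)
      map_zero' := by ext; simp
      map_add' := fun b b' => by ext; simp }

lemma relMap_apply (R : Type u) [Ring R] (M : Type u) [AddCommGroup M] [Module R M]
    (B : Type u) [AddCommGroup B] [Module Rᵐᵒᵖ B] (y : RelM R M →₀ B) (m : M) :
    relMap R M B y m = ∑ l : y.support, l.1.1 m • y l.1 := by
  rw [Finset.sum_coe_sort y.support (fun l => l.1 m • y l)]
  simp [relMap, Finsupp.sum, Finsupp.finsetSum_apply]

lemma relMap_single (R : Type u) [Ring R] (M : Type u) [AddCommGroup M] [Module R M]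
    (B : Type u) [AddCommGroup B] [Module Rᵐᵒᵖ B] (k : RelM R M) (b : B) :
    relMap R M B (Finsupp.single k b) = k.1.mapRange (fun r => r • b) (zero_smul _ b) := by
  rw [relMap, Finsupp.liftAddHom_apply_single]
  rfl

/-- For any left `R`-module `M`, the character module `M⁺ = Hom_ℤ(M, ℚ/ℤ)` is a pure
injective right `R`-module. -/
theorem stmt3 {R : Type u} [Ring R] (M : Type u) [AddCommGroup M] [Module R M] :
    IsPureInjective Rᵐᵒᵖ (CharMod M) := by
  intro A B _ _ _ _ i hi f
  classical
  let Q := (M →₀ B) ⧸ (relMap R M B).range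
  let π : (M →₀ B) →+ Q := QuotientAddGroup.mk' _
  let f' : M → A →+ AddCircle (1 : ℚ) := fun m =>
    { toFun := fun a => f a m
      map_zero' := by rw [map_zero]; rfl
      map_add' := fun a a' => by rw [map_add]; rfl }
  let χ : (M →₀ A) →+ AddCircle (1 : ℚ) := Finsupp.liftAddHom f'
  let p : (M →₀ A) →+ Q := π.comp (Finsupp.mapRange.addMonoidHom i.toAddMonoidHom)
  have key : ∀ x, p x = 0 → χ x = 0 := by
    intro x hx
    have hx' : Finsupp.mapRange.addMonoidHom i.toAddMonoidHom x ∈ (relMap R M B).range :=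
      (QuotientAddGroup.eq_zero_iff _).1 hx
    obtain ⟨y, hy⟩ := hx'
    obtain ⟨a, ha⟩ := pure_solve i hi (fun l : y.support => l.1.1) (fun l => y l.1) x (by
      intro m
      rw [← relMap_apply, hy]
      simp)
    have hx2 : x = ∑ l : y.support, (l.1.1).mapRange (fun r => r • a l) (zero_smul _ (a l)) := by
      ext m
      rw [ha m, Finsupp.finsetSum_apply]
      simp
    rw [hx2, map_sum]
    refine Finset.sum_eq_zero fun l _ => ?_
    have h1 : χ ((l.1.1).mapRange (fun r => r • a l) (zero_smul _ (a l)))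
        = l.1.1.sum fun m r => f (a l) (r.unop • m) := by
      simp only [χ, Finsupp.liftAddHom_apply]
      rw [Finsupp.sum_mapRange_index (fun m => map_zero _)]
      refine Finsupp.sum_congr fun m _ => ?_
      show f (_ • a l) m = _
      rw [map_smul]; rfl
    rw [h1]
    have h2 := congrArg (f (a l)) l.1.2
    rw [map_zero, Finsupp.sum, map_sum] at h2
    exact h2
  obtain ⟨χ', hχ'⟩ := char_extend p χ key
  have rel : ∀ (k : RelM R M) (b : B),
      χ' (π (k.1.mapRange (fun r => r • b) (zero_smul _ b))) = 0 := by
    intro k b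
    have : π (k.1.mapRange (fun r => r • b) (zero_smul _ b)) = 0 :=
      (QuotientAddGroup.eq_zero_iff _).2 ⟨_, relMap_single R M B k b⟩
    rw [this, map_zero]
  let G : B → M → AddCircle (1 : ℚ) := fun b m => χ' (π (Finsupp.single m b))
  have hGb : ∀ b b' m, G (b + b') m = G b m + G b' m := by
    intro b b' m
    simp only [G, Finsupp.single_add, map_add]
  have hGm : ∀ b m m', G b (m + m') = G b m + G b m' := by
    intro b m m'
    have h := rel ⟨Finsupp.single (m + m') 1 + (Finsupp.single m (-1) + Finsupp.single m' (-1)), by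
      rw [Finsupp.sum_add_index' (by simp) (by intros; simp [add_smul]),
        Finsupp.sum_add_index' (by simp) (by intros; simp [add_smul])]
      rw [Finsupp.sum_single_index (by simp), Finsupp.sum_single_index (by simp),
        Finsupp.sum_single_index (by simp)]
      simp only [unop_one, unop_neg, neg_smul, one_smul]
      abel⟩ b
    rw [Finsupp.mapRange_add (fun r s => add_smul r s b),
      Finsupp.mapRange_add (fun r s => add_smul r s b)] at h
    simp only [Finsupp.mapRange_single, one_smul, neg_smul] at h
    simp only [Finsupp.single_neg, map_add, map_neg] at h
    show χ' (π _) = χ' (π _) + χ' (π _)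
    rw [← sub_eq_zero, ← h]
    abel
  have hGr : ∀ (r : Rᵐᵒᵖ) b m, G (r • b) m = G b (r.unop • m) := by
    intro r b m
    have h := rel ⟨Finsupp.single m r + Finsupp.single (r.unop • m) (-1), by
      rw [Finsupp.sum_add_index' (by simp) (by intros; simp [add_smul])]
      rw [Finsupp.sum_single_index (by simp), Finsupp.sum_single_index (by simp)]
      simp only [unop_one, unop_neg, neg_smul, one_smul]
      abel⟩ b
    rw [Finsupp.mapRange_add (fun r s => add_smul r s b)] at h
    simp only [Finsupp.mapRange_single, one_smul, neg_smul] at h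
    simp only [Finsupp.single_neg, map_add, map_neg] at h
    show χ' (π _) = χ' (π _)
    rw [← sub_eq_zero, ← h]
    abel
  refine ⟨{ toFun := fun b => (AddMonoidHom.mk' (G b) (hGm b) : M →+ AddCircle (1 : ℚ))
            map_add' := fun b b' => AddMonoidHom.ext fun m => hGb b b' m
            map_smul' := fun r b => AddMonoidHom.ext fun m => hGr r b m }, ?_⟩
  refine LinearMap.ext fun a => AddMonoidHom.ext fun m => ?_
  show χ' (π (Finsupp.single m (i a))) = f a m
  have h := hχ' (Finsupp.single m a)
  simp only [p, χ, AddMonoidHom.comp_apply, Finsupp.liftAddHom_apply_single] at h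
  rw [Finsupp.mapRange.addMonoidHom_apply, Finsupp.mapRange_single] at h
  exact h
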